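/- Let G be a bipartite graph with unmixed binomial edge ideal (c_G(S) = |S| + 1 for all cut sets S). If S and T are cut sets of G with |S| = |T|, |S \ T| = 1, and S ∪ T is also a cut set of G, then S ∩ T is a cut set of G. -/

import Mathlib

open SimpleGraph Finset

/-- Number of connected components of the subgraph of `G` induced on the complement of `S`. -/
noncomputable def numComp {V : Type*} [Fintype V] (G : SimpleGraph V) (S : Finset V) : ℕ :=
  Nat.card (G.induce ((↑S : Set V)ᶜ)).ConnectedComponent

/-- `S` is a cut set of `G`. -/
def IsCutSet {V : Type*} [Fintype V] [DecidableEq V] (G : SimpleGraph V) (S : Finset V) : Prop :=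
  S = ∅ ∨ (S ≠ ∅ ∧ ∀ i ∈ S, numComp G (S.erase i) < numComp G S)

/-- The combinatorial condition equivalent to unmixedness of the binomial edge ideal. -/
def Unmixed {V : Type*} [Fintype V] [DecidableEq V] (G : SimpleGraph V) : Prop :=
  ∀ S : Finset V, IsCutSet G S → numComp G S = S.card + 1


section helpers
variable {V : Type*}

def HH (G : SimpleGraph V) (X : Finset V) : SimpleGraph V where
  Adj a b := G.Adj a b ∧ a ∉ X ∧ b ∉ X
  symm := ⟨fun _ _ h => ⟨h.1.symm, h.2.2, h.2.1⟩⟩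
  loopless := ⟨fun _ h => G.loopless.irrefl _ h.1⟩

def RR (G : SimpleGraph V) (X : Finset V) (a b : V) : Prop := (HH G X).Reachable a b

theorem reach_ind {H : SimpleGraph V} {a b : V} (h : H.Reachable a b) (P : V → Prop) (ha : P a)
    (hs : ∀ x y, H.Adj x y → P x → P y) : P b := by
  obtain ⟨w⟩ := h
  induction w with
  | nil => exact ha
  | cons hadj _ ih => exact ih (hs _ _ hadj ha)

theorem RR.ind {G : SimpleGraph V} {X : Finset V} {a b : V} (h : RR G X a b) (P : V → Prop)
    (ha : P a) (hs : ∀ x y, G.Adj x y → x ∉ X → y ∉ X → P x → P y) : P b :=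
  reach_ind h P ha (fun x y h => hs x y h.1 h.2.1 h.2.2)

theorem RR.rfl {G : SimpleGraph V} {X : Finset V} {a : V} : RR G X a a := Reachable.refl _
theorem RR.symm {G : SimpleGraph V} {X : Finset V} {a b : V} (h : RR G X a b) : RR G X b a :=
  Reachable.symm h
theorem RR.trans {G : SimpleGraph V} {X : Finset V} {a b c : V} (h : RR G X a b)
    (h' : RR G X b c) : RR G X a c := Reachable.trans h h'
theorem RR.adj {G : SimpleGraph V} {X : Finset V} {a b : V} (h : G.Adj a b) (ha : a ∉ X)
    (hb : b ∉ X) : RR G X a b := by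
  have : (HH G X).Adj a b := ⟨h, ha, hb⟩
  exact this.reachable
theorem RR.mono {G : SimpleGraph V} {X Y : Finset V} {a b : V} (h : RR G Y a b) (hXY : X ⊆ Y) :
    RR G X a b :=
  h.ind (RR G X a) RR.rfl fun _ _ hxy hx hy h =>
    h.trans (RR.adj hxy (fun h => hx (hXY h)) (fun h => hy (hXY h)))
theorem RR.notMem {G : SimpleGraph V} {X : Finset V} {a b : V} (h : RR G X a b) (ha : a ∉ X) :
    b ∉ X := h.ind (· ∉ X) ha fun _ _ _ _ hy _ => hy

def Two (G : SimpleGraph V) (X : Finset V) (i : V) : Prop :=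
  ∃ a b, G.Adj i a ∧ G.Adj i b ∧ a ∉ X ∧ b ∉ X ∧ ¬ RR G X a b

def Three (G : SimpleGraph V) (X : Finset V) (i : V) : Prop :=
  ∃ a b c, G.Adj i a ∧ G.Adj i b ∧ G.Adj i c ∧ a ∉ X ∧ b ∉ X ∧ c ∉ X ∧
    ¬ RR G X a b ∧ ¬ RR G X a c ∧ ¬ RR G X b c

def tset (G : SimpleGraph V) (X : Finset V) (i : V) : Set (HH G X).ConnectedComponent :=
  {c | ∃ w, G.Adj i w ∧ w ∉ X ∧ (HH G X).connectedComponentMk w = c}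

theorem mk_eq {G : SimpleGraph V} {X : Finset V} {a b : V} :
    (HH G X).connectedComponentMk a = (HH G X).connectedComponentMk b ↔ RR G X a b :=
  ConnectedComponent.eq

variable [Fintype V]

noncomputable def cc (G : SimpleGraph V) (X : Finset V) : ℕ := Nat.card (HH G X).ConnectedComponent
noncomputable def tch (G : SimpleGraph V) (X : Finset V) (i : V) : ℕ := (tset G X i).ncard

instance (H : SimpleGraph V) : Finite H.ConnectedComponent := Quot.finite _

theorem tch_two {G : SimpleGraph V} {X : Finset V} {i : V} : 2 ≤ tch G X i ↔ Two G X i := by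
  unfold tch
  rw [← Nat.lt_iff_add_one_le, Set.one_lt_ncard_iff]
  constructor
  · rintro ⟨_, _, ⟨a, ha, ha', rfl⟩, ⟨b, hb, hb', rfl⟩, h⟩
    exact ⟨a, b, ha, hb, ha', hb', fun h' => h (mk_eq.2 h')⟩
  · rintro ⟨a, b, ha, hb, ha', hb', h⟩
    exact ⟨_, _, ⟨a, ha, ha', rfl⟩, ⟨b, hb, hb', rfl⟩, fun h' => h (mk_eq.1 h')⟩

theorem tch_three {G : SimpleGraph V} {X : Finset V} {i : V} : 3 ≤ tch G X i ↔ Three G X i := by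
  unfold tch
  rw [← Nat.lt_iff_add_one_le, Set.two_lt_ncard_iff]
  constructor
  · rintro ⟨_, _, _, ⟨a, ha, ha', rfl⟩, ⟨b, hb, hb', rfl⟩, ⟨c, hc, hc', rfl⟩, h, h', h''⟩
    exact ⟨a, b, c, ha, hb, hc, ha', hb', hc', fun k => h (mk_eq.2 k), fun k => h' (mk_eq.2 k),
      fun k => h'' (mk_eq.2 k)⟩
  · rintro ⟨a, b, c, ha, hb, hc, ha', hb', hc', h, h', h''⟩
    exact ⟨_, _, _, ⟨a, ha, ha', rfl⟩, ⟨b, hb, hb', rfl⟩, ⟨c, hc, hc', rfl⟩,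
      fun k => h (mk_eq.1 k), fun k => h' (mk_eq.1 k), fun k => h'' (mk_eq.1 k)⟩

theorem tch_four {G : SimpleGraph V} {X : Finset V} {i : V} (h4 : 4 ≤ tch G X i) (t : V) :
    ∃ a b c, G.Adj i a ∧ G.Adj i b ∧ G.Adj i c ∧ a ∉ X ∧ b ∉ X ∧ c ∉ X ∧
    ¬ RR G X a b ∧ ¬ RR G X a c ∧ ¬ RR G X b c ∧ a ≠ t ∧ b ≠ t ∧ c ≠ t := by
  have h3 : 2 < (tset G X i \ {(HH G X).connectedComponentMk t}).ncard := by
    have := Set.pred_ncard_le_ncard_sdiff_singleton (tset G X i) ((HH G X).connectedComponentMk t)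
    unfold tch at h4
    omega
  rw [Set.two_lt_ncard_iff] at h3
  obtain ⟨_, _, _, ⟨⟨a, ha, ha', rfl⟩, hat⟩, ⟨⟨b, hb, hb', rfl⟩, hbt⟩, ⟨⟨c, hc, hc', rfl⟩, hct⟩,
    h, h', h''⟩ := h3
  refine ⟨a, b, c, ha, hb, hc, ha', hb', hc', fun k => h (mk_eq.2 k), fun k => h' (mk_eq.2 k),
      fun k => h'' (mk_eq.2 k), ?_, ?_, ?_⟩
  · rintro rfl; exact hat rfl
  · rintro rfl; exact hbt rfl
  · rintro rfl; exact hct rfl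

theorem cc_numComp (G : SimpleGraph V) (X : Finset V) : cc G X = numComp G X + X.card := by
  let φ : G.induce ((↑X : Set V)ᶜ) →g HH G X :=
    ⟨fun v => v.1, fun {a b} h => ⟨h, fun k => a.2 (by simpa using k), fun k => b.2 (by simpa using k)⟩⟩
  let f : (G.induce ((↑X : Set V)ᶜ)).ConnectedComponent ⊕ X → (HH G X).ConnectedComponent :=
    Sum.elim (fun c => c.map φ) (fun x => (HH G X).connectedComponentMk x.1)
  have hf : Function.Bijective f := by
    constructor
    · rintro (c | x) (d | y) h
      · congr 1
        induction c using ConnectedComponent.ind with | _ a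
        induction d using ConnectedComponent.ind with | _ b
        have h1 : RR G X a.1 b.1 := mk_eq.1 h
        have := h1.ind (fun y => ∃ hy : y ∈ (↑X : Set V)ᶜ,
          (G.induce ((↑X : Set V)ᶜ)).Reachable a ⟨y, hy⟩) ⟨a.2, Reachable.refl _⟩ (by
            rintro x y hxy hx hy ⟨h1, h2⟩
            refine ⟨by simpa using hy, h2.trans (Adj.reachable ?_)⟩
            exact hxy)
        obtain ⟨_, h2⟩ := this
        exact ConnectedComponent.eq.2 h2
      · exfalso
        induction c using ConnectedComponent.ind with | _ a
        have h1 : RR G X a.1 y.1 := mk_eq.1 h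
        exact h1.notMem (fun k => a.2 (mem_coe.2 k)) y.2
      · exfalso
        induction d using ConnectedComponent.ind with | _ a
        have h1 : RR G X x.1 a.1 := mk_eq.1 h
        exact h1.symm.notMem (fun k => a.2 (mem_coe.2 k)) x.2
      · have h1 : RR G X x.1 y.1 := mk_eq.1 h
        have := h1.ind (fun z => z = x.1) rfl (fun a b _ ha _ k => absurd (k ▸ x.2) ha)
        congr 1
        exact Subtype.ext this.symm
    · intro c
      induction c using ConnectedComponent.ind with | _ a
      by_cases ha : a ∈ X
      · exact ⟨Sum.inr ⟨a, ha⟩, rfl⟩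
      · exact ⟨Sum.inl ((G.induce ((↑X : Set V)ᶜ)).connectedComponentMk ⟨a, by simpa using ha⟩), rfl⟩
  unfold cc numComp
  rw [← Nat.card_eq_of_bijective f hf, Nat.card_sum]
  simp

variable [DecidableEq V]

theorem cc_erase (G : SimpleGraph V) (X : Finset V) (i : V) (hi : i ∈ X) :
    cc G X = cc G (X.erase i) + tch G X i := by
  have key : ∀ a b, RR G (X.erase i) a b → RR G X a b ∨
      ((a = i ∨ (HH G X).connectedComponentMk a ∈ tset G X i) ∧
       (b = i ∨ (HH G X).connectedComponentMk b ∈ tset G X i)) := by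
    intro a b h
    refine h.ind (fun b => RR G X a b ∨
      ((a = i ∨ (HH G X).connectedComponentMk a ∈ tset G X i) ∧
       (b = i ∨ (HH G X).connectedComponentMk b ∈ tset G X i))) (Or.inl RR.rfl) ?_
    intro x y hxy hx hy hP
    by_cases hxi : x = i
    · subst hxi
      have hy' : y ∉ X := fun k => hy (mem_erase.2 ⟨hxy.ne', k⟩)
      have hyt : (HH G X).connectedComponentMk y ∈ tset G X x := ⟨y, hxy, hy', rfl⟩
      rcases hP with h1 | ⟨h1, _⟩
      · have hax : a = x := by
          refine h1.symm.ind (fun z => z = x) rfl (fun u v _ hu _ k => absurd (k ▸ hi) hu)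
        exact Or.inr ⟨Or.inl hax, Or.inr hyt⟩
      · exact Or.inr ⟨h1, Or.inr hyt⟩
    · have hx' : x ∉ X := fun k => hx (mem_erase.2 ⟨hxi, k⟩)
      by_cases hyi : y = i
      · subst hyi
        have hxt : (HH G X).connectedComponentMk x ∈ tset G X y := ⟨x, hxy.symm, hx', rfl⟩
        rcases hP with h1 | ⟨h1, _⟩
        · refine Or.inr ⟨Or.inr ?_, Or.inl rfl⟩
          rw [mk_eq.2 h1]; exact hxt
        · exact Or.inr ⟨h1, Or.inl rfl⟩
      · have hy' : y ∉ X := fun k => hy (mem_erase.2 ⟨hyi, k⟩)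
        have hr : RR G X x y := RR.adj hxy hx' hy'
        rcases hP with h1 | ⟨h1, h2⟩
        · exact Or.inl (h1.trans hr)
        · refine Or.inr ⟨h1, Or.inr ?_⟩
          rcases h2 with h2 | h2
          · exact absurd h2 hxi
          · rw [← mk_eq.2 hr]; exact h2
  let π : (HH G X).ConnectedComponent → (HH G (X.erase i)).ConnectedComponent :=
    ConnectedComponent.map (Hom.ofLE (by
      intro a b h
      exact ⟨h.1, fun k => h.2.1 (mem_of_mem_erase k), fun k => h.2.2 (mem_of_mem_erase k)⟩))
  have hπ : ∀ a, π ((HH G X).connectedComponentMk a) = (HH G (X.erase i)).connectedComponentMk a :=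
    fun a => rfl
  have hiN : (HH G X).connectedComponentMk i ∉ tset G X i := by
    rintro ⟨w, _, hw, h⟩
    exact (mk_eq.1 h).notMem hw hi
  have hb : Set.BijOn π (tset G X i)ᶜ Set.univ := by
    refine ⟨fun _ _ => trivial, ?_, ?_⟩
    · intro c hc d hd h
      induction c using ConnectedComponent.ind with | _ a
      induction d using ConnectedComponent.ind with | _ b
      rw [hπ, hπ, mk_eq] at h
      rcases key a b h with h1 | ⟨h1, h2⟩
      · exact mk_eq.2 h1
      · rcases h1 with rfl | h1
        · rcases h2 with rfl | h2
          · rfl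
          · exact absurd h2 hd
        · exact absurd h1 hc
    · intro c _
      induction c using ConnectedComponent.ind with | _ a
      by_cases ha : (HH G X).connectedComponentMk a ∈ tset G X i
      · refine ⟨_, hiN, ?_⟩
        rw [hπ, mk_eq]
        obtain ⟨w, hw, hwX, h⟩ := ha
        have h1 : RR G (X.erase i) w a := (mk_eq.1 h).mono (erase_subset _ _)
        exact (RR.adj hw (by simp) (fun k => hwX (mem_of_mem_erase k))).trans h1
      · exact ⟨_, ha, hπ a⟩
  have h1 : (tset G X i)ᶜ.ncard = cc G (X.erase i) := by
    have := Set.ncard_image_of_injOn hb.injOn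
    rw [hb.image_eq, Set.ncard_univ] at this
    exact this.symm
  have h2 := Set.ncard_add_ncard_compl (tset G X i)
  unfold cc tch at *
  omega

theorem cut_iff (G : SimpleGraph V) (X : Finset V) : IsCutSet G X ↔ ∀ i ∈ X, Two G X i := by
  have h : ∀ i ∈ X, (numComp G (X.erase i) < numComp G X ↔ Two G X i) := by
    intro i hi
    have h1 := cc_erase G X i hi
    rw [cc_numComp, cc_numComp] at h1
    have h2 := card_erase_add_one hi
    rw [← tch_two]
    omega
  unfold IsCutSet
  constructor
  · rintro (rfl | ⟨_, h'⟩) i hi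
    · simp at hi
    · exact (h i hi).1 (h' i hi)
  · intro h'
    by_cases hX : X = ∅
    · exact Or.inl hX
    · exact Or.inr ⟨hX, fun i hi => (h i hi).2 (h' i hi)⟩

theorem unm_le {G : SimpleGraph V} (hu : Unmixed G) (X : Finset V) :
    cc G X ≤ 2 * X.card + 1 ∧ (¬ IsCutSet G X → cc G X ≤ 2 * X.card) := by
  induction hn : X.card generalizing X with
  | zero =>
    have hX : X = ∅ := card_eq_zero.1 hn
    have hc : IsCutSet G X := Or.inl hX
    have := hu X hc
    rw [cc_numComp]
    exact ⟨by omega, fun h => absurd hc h⟩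
  | succ n ih =>
    by_cases hc : IsCutSet G X
    · have := hu X hc
      rw [cc_numComp]
      exact ⟨by omega, fun h => absurd hc h⟩
    · have hc' := hc
      rw [cut_iff] at hc'
      push Not at hc'
      obtain ⟨i, hi, h2⟩ := hc'
      rw [← tch_two] at h2
      have h1 := cc_erase G X i hi
      have h3 := card_erase_add_one hi
      have h4 := (ih (X.erase i) (by omega)).1
      exact ⟨by omega, fun _ => by omega⟩

theorem unm_cut {G : SimpleGraph V} (hu : Unmixed G) (X : Finset V) :
    IsCutSet G X ↔ cc G X = 2 * X.card + 1 := by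
  constructor
  · intro h
    have := hu X h
    rw [cc_numComp]; omega
  · intro h
    by_contra hc
    have := (unm_le hu X).2 hc
    omega

/-- Adjacent structure of `s`, `t` derived from the counts. -/
theorem struct_st {G : SimpleGraph V} {U : Finset V} {s t : V}
    (h3 : Three G (insert s U) s) (hn3 : ¬ Three G (insert t (insert s U)) s) :
    G.Adj s t ∧ (∃ p q, G.Adj s p ∧ G.Adj s q ∧ p ∉ insert s U ∧ q ∉ insert s U ∧
      ¬ RR G (insert s U) p q ∧ ¬ RR G (insert s U) p t ∧ ¬ RR G (insert s U) q t) ∧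
      (∀ r, G.Adj s r → r ∉ U → RR G (insert s U) r t → r = t) := by
  have hno : ∀ a b c, G.Adj s a → G.Adj s b → G.Adj s c → a ∉ insert s U → b ∉ insert s U →
      c ∉ insert s U → ¬ RR G (insert s U) a b → ¬ RR G (insert s U) a c →
      ¬ RR G (insert s U) b c → a ≠ t → b ≠ t → c ≠ t → False := by
    intro a b c ha hb hc ha' hb' hc' h1 h2 h3 hat hbt hct
    refine hn3 ⟨a, b, c, ha, hb, hc, ?_, ?_, ?_, fun k => h1 (k.mono (subset_insert _ _)),
      fun k => h2 (k.mono (subset_insert _ _)), fun k => h3 (k.mono (subset_insert _ _))⟩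
    · rw [mem_insert]; tauto
    · rw [mem_insert]; tauto
    · rw [mem_insert]; tauto
  have hpq : G.Adj s t ∧ (∃ p q, G.Adj s p ∧ G.Adj s q ∧ p ∉ insert s U ∧ q ∉ insert s U ∧
      ¬ RR G (insert s U) p q ∧ ¬ RR G (insert s U) p t ∧ ¬ RR G (insert s U) q t) := by
    obtain ⟨a, b, c, ha, hb, hc, ha', hb', hc', h1, h2, h3⟩ := h3
    by_cases hat : a = t
    · subst hat
      exact ⟨ha, b, c, hb, hc, hb', hc', h3, fun k => h1 k.symm, fun k => h2 k.symm⟩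
    by_cases hbt : b = t
    · subst hbt
      exact ⟨hb, a, c, ha, hc, ha', hc', h2, h1, fun k => h3 k.symm⟩
    by_cases hct : c = t
    · subst hct
      exact ⟨hc, a, b, ha, hb, ha', hb', h1, h2, h3⟩
    exact (hno a b c ha hb hc ha' hb' hc' h1 h2 h3 hat hbt hct).elim
  refine ⟨hpq.1, hpq.2, ?_⟩
  obtain ⟨_, p, q, hp, hq, hp', hq', h1, h2, h3⟩ := hpq
  intro r hr hrU hrt
  by_contra hne
  refine hno p q r hp hq hr hp' hq' ?_ h1 (fun k => h2 (k.trans hrt)) (fun k => h3 (k.trans hrt))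
    ?_ ?_ hne
  · rw [mem_insert]; rintro (k | k)
    · exact hr.ne' k
    · exact hrU k
  · rintro rfl; exact h2 RR.rfl
  · rintro rfl; exact h3 RR.rfl

theorem bad_reach {G : SimpleGraph V} {U : Finset V} {s v : V}
    (h2 : Two G (insert s U) v) (hbad : ¬ Two G U v) (hs : s ∉ U) :
    ∀ e, G.Adj v e → e ∉ U → RR G U e s := by
  obtain ⟨a, b, ha, hb, ha', hb', hab⟩ := h2
  have haU : a ∉ U := fun k => ha' (mem_insert_of_mem k)
  have hbU : b ∉ U := fun k => hb' (mem_insert_of_mem k)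
  have hall : ∀ x y, G.Adj v x → G.Adj v y → x ∉ U → y ∉ U → RR G U x y := by
    intro x y hx hy hx' hy'
    by_contra hc
    exact hbad ⟨x, y, hx, hy, hx', hy', hc⟩
  have has : RR G U a s := by
    by_contra hc
    refine hab ?_
    have := (hall a b ha hb haU hbU).ind (fun y => RR G (insert s U) a y ∧ RR G U a y)
      ⟨RR.rfl, RR.rfl⟩ (by
        rintro x y hxy hx hy ⟨h1, h1'⟩
        have h2 : RR G U a y := h1'.trans (RR.adj hxy hx hy)
        refine ⟨h1.trans (RR.adj hxy (h1.notMem ha') ?_), h2⟩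
        rw [mem_insert]
        rintro (rfl | k)
        · exact hc h2
        · exact hy k)
    exact this.1
  intro e he he'
  exact (hall e a he ha he' haU).trans has

theorem bad_unique {G : SimpleGraph V} {U : Finset V} {s u v : V} (hs : s ∉ U)
    (hu2 : Two G (insert s U) u) (hv2 : Two G (insert s U) v)
    (hub : ¬ Two G U u) (hvb : ¬ Two G U v)
    (hv' : Two G (U.erase u) v) : False := by
  have hur := bad_reach hu2 hub hs
  have hvr := bad_reach hv2 hvb hs
  have hus : RR G (U.erase u) u s := by
    obtain ⟨a, b, ha, hb, ha', hb', hab⟩ := hu2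
    have haU : a ∉ U := fun k => ha' (mem_insert_of_mem k)
    exact (RR.adj ha (by simp) (fun k => haU (mem_of_mem_erase k))).trans
      ((hur a ha haU).mono (erase_subset _ _))
  obtain ⟨a, b, ha, hb, ha', hb', hab⟩ := hv'
  have h : ∀ x, G.Adj v x → x ∉ U.erase u → RR G (U.erase u) x s := by
    intro x hx hx'
    by_cases hxu : x = u
    · subst hxu; exact hus
    · exact (hvr x hx (fun k => hx' (mem_erase.2 ⟨hxu, k⟩))).mono (erase_subset _ _)
  exact hab ((h a ha ha').trans (h b hb hb').symm)

theorem core {G : SimpleGraph V} (hun : Unmixed G) {U : Finset V} {s t u : V} (c : V → Bool)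
    (hc : ∀ a b, G.Adj a b → c a ≠ c b)
    (hs : s ∉ U) (ht : t ∉ U) (hst : G.Adj s t)
    (hS : ∀ i ∈ insert s U, Two G (insert s U) i) (hT : ∀ i ∈ insert t U, Two G (insert t U) i)
    (hpq : ∃ p q, G.Adj s p ∧ G.Adj s q ∧ p ∉ insert s U ∧ q ∉ insert s U ∧
      ¬ RR G (insert s U) p q ∧ ¬ RR G (insert s U) p t ∧ ¬ RR G (insert s U) q t)
    (hsr : ∀ r, G.Adj s r → r ∉ U → RR G (insert s U) r t → r = t)
    (hcu : c u = c s) (hgood : ∀ v ∈ U, v ≠ u → Two G U v) : False := by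
  classical
  have hcc : ∀ a b, G.Adj a b → (c a = c s ↔ ¬ c b = c s) := by
    intro a b h
    have := hc a b h
    revert this
    cases c a <;> cases c b <;> cases c s <;> simp
  have hct : ¬ c t = c s := (hcc s t hst).1 rfl
  have htS : t ∉ insert s U := by
    rw [mem_insert]; rintro (k | k)
    · exact hst.ne' k
    · exact ht k
  let Z : Finset V := univ.filter fun z => c z = c s ∧ RR G (insert s U) z t ∧
    ∃ x y, x ≠ y ∧ G.Adj z x ∧ G.Adj z y ∧ x ∉ insert s U ∧ y ∉ insert s U
  have hZ : ∀ z, z ∈ Z ↔ (c z = c s ∧ RR G (insert s U) z t ∧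
    ∃ x y, x ≠ y ∧ G.Adj z x ∧ G.Adj z y ∧ x ∉ insert s U ∧ y ∉ insert s U) := by
    intro z; simp [Z]
  obtain ⟨X, hX⟩ : ∃ X, X = U ∪ Z := ⟨_, rfl⟩
  have hXm : ∀ x, x ∈ X ↔ x ∈ U ∨ x ∈ Z := by intro x; rw [hX, mem_union]
  have hUX : U ⊆ X := by rw [hX]; exact subset_union_left
  have hsX : s ∉ X := by
    rw [hXm]; rintro (k | k)
    · exact hs k
    · exact (((hZ s).1 k).2.1.symm.notMem htS) (mem_insert_self _ _)
  have hZs : ∀ z ∈ Z, RR G U z s := by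
    intro z hz
    exact (((hZ z).1 hz).2.1.mono (subset_insert _ _)).trans (RR.adj hst.symm ht hs)
  -- local component structure
  have L : ∀ x y, x ∉ insert s U → x ≠ t → RR G (insert s U) x t → ¬ c x = c s → RR G X x y →
      y = x ∨ G.Adj x y := by
    intro x y hxS hxt hxr hcx hxy
    have hxs : ¬ G.Adj s x := fun k =>
      hxt (hsr x k (fun k' => hxS (mem_insert_of_mem k')) hxr)
    have := hxy.ind (fun y => y = x ∨ (G.Adj x y ∧ y ∉ X)) (Or.inl rfl) (by
      rintro y y' hyy hy hy' (rfl | ⟨h1, h2⟩)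
      · exact Or.inr ⟨hyy, hy'⟩
      · left
        have hys : y ≠ s := by rintro rfl; exact hxs h1.symm
        have hyS : y ∉ insert s U := by
          rw [mem_insert]; rintro (k | k)
          · exact hys k
          · exact h2 (hUX k)
        have hcy : c y = c s := (hcc y x h1.symm).2 hcx
        have hyr : RR G (insert s U) y t := (RR.adj h1.symm hyS hxS).trans hxr
        by_contra hne
        apply hy
        rw [hXm]; right
        rw [hZ]
        refine ⟨hcy, hyr, y', x, hne, hyy, h1.symm, ?_, hxS⟩
        rw [mem_insert]; rintro (k | k)
        · exact (hcc y y' hyy).1 hcy (by rw [k])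
        · exact hy' (hUX k))
    rcases this with k | k
    · exact Or.inl k
    · exact Or.inr k.1
  have hnX : ∀ x, ¬ c x = c s → x ∉ U → x ∉ X := by
    intro x h1 h2
    rw [hXm]; rintro (k | k)
    · exact h2 k
    · exact h1 ((hZ x).1 k).1
  -- elements of Z are cut in X
  have hZ2 : ∀ z ∈ Z, Two G X z := by
    intro z hz
    obtain ⟨hcz, hzr, x, y, hxy, hx, hy, hxS, hyS⟩ := (hZ z).1 hz
    have hzS : z ∉ insert s U := hzr.symm.notMem htS
    have hcx := (hcc z x hx).1 hcz
    have hcy := (hcc z y hy).1 hcz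
    have hxX := hnX x hcx (fun k => hxS (mem_insert_of_mem k))
    have hyX := hnX y hcy (fun k => hyS (mem_insert_of_mem k))
    have hnadj : ¬ G.Adj x y := fun k => hcx ((hcc x y k).2 hcy)
    refine ⟨x, y, hx, hy, hxX, hyX, ?_⟩
    intro hr
    by_cases hxt : x = t
    · have hyt : y ≠ t := fun k => hxy (hxt.trans k.symm)
      rcases L y x hyS hyt ((RR.adj hy.symm hyS hzS).trans hzr) hcy hr.symm with k | k
      · exact hxy k
      · exact hnadj k.symm
    · rcases L x y hxS hxt ((RR.adj hx.symm hxS hzS).trans hzr) hcx hr with k | k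
      · exact hxy k.symm
      · exact hnadj k
  -- elements of U on the side of s are cut in X
  have hU2 : ∀ v ∈ U, c v = c s → Two G X v := by
    intro v hv hcv
    by_cases hg : Two G U v
    · obtain ⟨a, b, ha, hb, ha', hb', hab⟩ := hg
      exact ⟨a, b, ha, hb, hnX a ((hcc v a ha).1 hcv) ha', hnX b ((hcc v b hb).1 hcv) hb',
        fun k => hab (k.mono hUX)⟩
    · have hr := bad_reach (hS v (mem_insert_of_mem hv)) hg hs
      obtain ⟨e, he, heT, hes⟩ : ∃ e, G.Adj v e ∧ e ∉ insert t U ∧ ¬ RR G (insert t U) e s := by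
        obtain ⟨a, b, ha, hb, ha', hb', hab⟩ := hT v (mem_insert_of_mem hv)
        by_cases h : RR G (insert t U) a s
        · exact ⟨b, hb, hb', fun k => hab (h.trans k.symm)⟩
        · exact ⟨a, ha, ha', h⟩
      have heU : e ∉ U := fun k => heT (mem_insert_of_mem k)
      have het : e ≠ t := by rintro rfl; exact heT (mem_insert_self _ _)
      have hes' : e ≠ s := by rintro rfl; exact hes RR.rfl
      have heS : e ∉ insert s U := by
        rw [mem_insert]; rintro (k | k)
        · exact hes' k
        · exact heU k
      have hest : RR G (insert s U) e t := by
        by_contra hcon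
        have := (hr e he heU).ind (fun y => RR G (insert s U) e y ∧ RR G (insert t U) e y)
          ⟨RR.rfl, RR.rfl⟩ (by
            rintro y y' hyy hy hy' ⟨h1, h2⟩
            have hyS := h1.notMem heS
            have hyT := h2.notMem heT
            have hys : y' ≠ s := by
              rintro rfl
              refine hes (h2.trans (RR.adj hyy hyT ?_))
              rw [mem_insert]; rintro (k | k)
              · exact hst.ne k
              · exact hs k
            have hyt : y' ≠ t := by
              rintro rfl
              exact hcon (h1.trans (RR.adj hyy hyS htS))
            exact ⟨h1.trans (RR.adj hyy hyS (by rw [mem_insert]; tauto)),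
              h2.trans (RR.adj hyy hyT (by rw [mem_insert]; tauto))⟩)
        exact hes this.2
      obtain ⟨f, hf, hfU, hfe⟩ : ∃ f, G.Adj v f ∧ f ∉ U ∧ f ≠ e := by
        obtain ⟨a, b, ha, hb, ha', hb', hab⟩ := hS v (mem_insert_of_mem hv)
        by_cases h : a = e
        · refine ⟨b, hb, fun k => hb' (mem_insert_of_mem k), ?_⟩
          rintro rfl
          subst h
          exact hab RR.rfl
        · exact ⟨a, ha, fun k => ha' (mem_insert_of_mem k), h⟩
      have hce := (hcc v e he).1 hcv
      have hcf := (hcc v f hf).1 hcv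
      refine ⟨e, f, he, hf, hnX e hce heU, hnX f hcf hfU, ?_⟩
      intro hrr
      rcases L e f heS het hest hce hrr with k | k
      · exact hfe k
      · exact hce ((hcc e f k).2 hcf)
  -- the removed set
  let R : Finset V := U.filter fun v => ¬ Two G X v
  have hR : ∀ v, v ∈ R ↔ v ∈ U ∧ ¬ Two G X v := by intro v; simp [R]
  have hRc : ∀ v ∈ R, ¬ c v = c s := fun v hv k =>
    ((hR v).1 hv).2 (hU2 v ((hR v).1 hv).1 k)
  have hRr : ∀ v ∈ R, ∀ w, G.Adj v w → w ∉ X → ¬ RR G U w s := by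
    intro v hv w hw hwX hws
    obtain ⟨hvU, hvn⟩ := (hR v).1 hv
    have hvu : v ≠ u := by rintro rfl; exact hRc _ hv hcu
    obtain ⟨b, hb, hbU, hbs⟩ : ∃ b, G.Adj v b ∧ b ∉ U ∧ ¬ RR G U b s := by
      obtain ⟨a, b, ha, hb, ha', hb', hab⟩ := hgood v hvU hvu
      by_cases h : RR G U a s
      · exact ⟨b, hb, hb', fun k => hab (h.trans k.symm)⟩
      · exact ⟨a, ha, ha', h⟩
    have hbX : b ∉ X := by
      rw [hXm]; rintro (k | k)
      · exact hbU k
      · exact hbs (hZs b k)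
    exact hvn ⟨w, b, hw, hb, hwX, hbX, fun k => hbs ((k.mono hUX).symm.trans hws)⟩
  obtain ⟨X', hX'⟩ : ∃ X', X' = X \ R := ⟨_, rfl⟩
  have hXm' : ∀ x, x ∈ X' ↔ x ∈ X ∧ x ∉ R := by intro x; rw [hX', mem_sdiff]
  have hRX : ∀ v ∈ R, v ∈ X := fun v hv => hUX ((hR v).1 hv).1
  have hback : ∀ a b, a ∉ X → b ∉ X → RR G X' a b → RR G X a b := by
    intro a b ha hb hab
    have := hab.ind (fun y => (y ∉ X ∧ RR G X a y) ∨
      (y ∈ R ∧ ∃ w, w ∉ X ∧ G.Adj y w ∧ RR G X a w)) (Or.inl ⟨ha, RR.rfl⟩) (by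
        rintro y y' hyy hy hy' (⟨h0, h1⟩ | ⟨h1, w, hw, hyw, haw⟩)
        · by_cases hy'R : y' ∈ R
          · exact Or.inr ⟨hy'R, y, h0, hyy.symm, h1⟩
          · have : y' ∉ X := fun k => hy' ((hXm' y').2 ⟨k, hy'R⟩)
            exact Or.inl ⟨this, h1.trans (RR.adj hyy h0 this)⟩
        · have hy'R : y' ∉ R := fun k => hRc y h1 ((hcc y y' hyy).2 (hRc y' k))
          have hy'X : y' ∉ X := fun k => hy' ((hXm' y').2 ⟨k, hy'R⟩)
          left
          refine ⟨hy'X, haw.trans ?_⟩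
          by_contra hcon
          exact ((hR y).1 h1).2 ⟨w, y', hyw, hyy, hw, hy'X, hcon⟩)
    rcases this with k | k
    · exact k.2
    · exact absurd (hRX b k.1) hb
  have hcutX : ∀ x ∈ X', Two G X' x := by
    intro x hx
    obtain ⟨hxX, hxR⟩ := (hXm' x).1 hx
    have : Two G X x := by
      rcases (hXm x).1 hxX with k | k
      · by_contra hcon
        exact hxR ((hR x).2 ⟨k, hcon⟩)
      · exact hZ2 x k
    obtain ⟨a, b, ha, hb, ha', hb', hab⟩ := this
    exact ⟨a, b, ha, hb, fun k => ha' ((hXm' a).1 k).1, fun k => hb' ((hXm' b).1 k).1,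
      fun k => hab (hback a b ha' hb' k)⟩
  have hsX' : s ∉ X' := fun k => hsX ((hXm' s).1 k).1
  have hfwd : ∀ p b, G.Adj s p → p ∉ insert s U → RR G (insert s X') p b →
      RR G (insert s U) p b := by
    intro p b hp hpS hpb
    refine hpb.ind (fun y => RR G (insert s U) p y) RR.rfl ?_
    intro y y' hyy hy hy' h
    have hyS := h.notMem hpS
    have hyX : y ∉ X := by
      intro k
      refine hy (mem_insert_of_mem ((hXm' y).2 ⟨k, fun k' => ?_⟩))
      exact hyS (mem_insert_of_mem ((hR y).1 k').1)
    have hpU : p ∉ U := fun k => hpS (mem_insert_of_mem k)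
    have hy'R : y' ∉ R := by
      intro k
      refine hRr y' k y hyy.symm hyX ?_
      exact (h.symm.mono (subset_insert _ _)).trans (RR.adj hp.symm hpU hs)
    refine h.trans (RR.adj hyy hyS ?_)
    rw [mem_insert]; rintro (k | k)
    · exact hy' (k ▸ mem_insert_self _ _)
    · exact hy' (mem_insert_of_mem ((hXm' y').2 ⟨hUX k, hy'R⟩))
  obtain ⟨p, q, hp, hq, hpS, hqS, h1, h2, h3⟩ := hpq
  have hnot : ∀ p, p ∉ insert s U → ¬ RR G (insert s U) p t → p ∉ insert s X' := by
    intro p hpS hpt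
    rw [mem_insert]; rintro (k | k)
    · exact hpS (k ▸ mem_insert_self _ _)
    · rcases (hXm p).1 ((hXm' p).1 k).1 with k | k
      · exact hpS (mem_insert_of_mem k)
      · exact hpt ((hZ p).1 k).2.1
  have htX' : t ∉ insert s X' := by
    rw [mem_insert]; rintro (k | k)
    · exact hst.ne' k
    · exact hnX t hct ht ((hXm' t).1 k).1
  have hthree : Three G (insert s X') s :=
    ⟨p, q, t, hp, hq, hst, hnot p hpS h2, hnot q hqS h3, htX',
      fun k => h1 (hfwd p q hp hpS k), fun k => h2 (hfwd p t hp hpS k),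
      fun k => h3 (hfwd q t hq hqS k)⟩
  have e1 := (unm_cut hun X').1 ((cut_iff G X').2 hcutX)
  have e2 := (unm_le hun (insert s X')).1
  have e3 := cc_erase G (insert s X') s (mem_insert_self _ _)
  rw [erase_insert hsX'] at e3
  rw [card_insert_of_notMem hsX'] at e2
  have e4 := tch_three.2 hthree
  omega

theorem count_step {G : SimpleGraph V} {X : Finset V} {i : V} (hi : i ∉ X) :
    cc G (insert i X) = cc G X + tch G (insert i X) i := by
  have := cc_erase G (insert i X) i (mem_insert_self _ _)
  rwa [erase_insert hi] at this

theorem main_aux {G : SimpleGraph V} (hun : Unmixed G) {U : Finset V} {s t : V} (c : V → Bool)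
    (hc : ∀ a b, G.Adj a b → c a ≠ c b)
    (hs : s ∉ U) (ht : t ∉ U) (hne : s ≠ t)
    (hS : IsCutSet G (insert s U)) (hT : IsCutSet G (insert t U))
    (hW : IsCutSet G (insert t (insert s U))) : IsCutSet G U := by
  by_contra hU
  have hsT : s ∉ insert t U := by rw [mem_insert]; tauto
  have htS : t ∉ insert s U := by
    rw [mem_insert]; rintro (k | k)
    · exact hne k.symm
    · exact ht k
  have dU := (unm_le hun U).2 hU
  have dS := (unm_cut hun _).1 hS
  have dT := (unm_cut hun _).1 hT
  have dW := (unm_cut hun _).1 hW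
  have kS := count_step (G := G) hs
  have kT := count_step (G := G) ht
  have kSW := count_step (G := G) htS
  have kTW := count_step (G := G) hsT
  rw [Finset.insert_comm s t U] at kTW
  rw [card_insert_of_notMem hs] at dS
  rw [card_insert_of_notMem ht] at dT
  rw [card_insert_of_notMem htS, card_insert_of_notMem hs] at dW
  have s3 : Three G (insert s U) s := tch_three.1 (by omega)
  have t3 : Three G (insert t U) t := tch_three.1 (by omega)
  have sn3 : ¬ Three G (insert t (insert s U)) s := by rw [← tch_three]; omega
  have tn3 : ¬ Three G (insert s (insert t U)) t := by
    rw [Finset.insert_comm, ← tch_three]; omega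
  have s4 : tch G (insert s U) s ≤ 3 := by
    by_contra h4
    obtain ⟨a, b, c, ha, hb, hc, ha', hb', hc', h1, h2, h3, hat, hbt, hct⟩ :=
      tch_four (G := G) (X := insert s U) (i := s) (by omega) t
    refine sn3 ⟨a, b, c, ha, hb, hc, ?_, ?_, ?_, fun k => h1 (k.mono (subset_insert _ _)),
      fun k => h2 (k.mono (subset_insert _ _)), fun k => h3 (k.mono (subset_insert _ _))⟩
    · rw [mem_insert]; tauto
    · rw [mem_insert]; tauto
    · rw [mem_insert]; tauto
  obtain ⟨hst, hpqs, hsr⟩ := struct_st s3 sn3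
  obtain ⟨_, hpqt, htr⟩ := struct_st t3 tn3
  have hS2 := (cut_iff _ _).1 hS
  have hT2 := (cut_iff _ _).1 hT
  have hU' := hU
  rw [cut_iff] at hU'
  push Not at hU'
  obtain ⟨u, hu, hub⟩ := hU'
  have hgood : ∀ v ∈ U, v ≠ u → Two G U v := by
    intro v hv hvu
    by_contra hvb
    have hcut : IsCutSet G (U.erase u) := by
      rw [unm_cut hun]
      have e1 := cc_erase G U u hu
      have e2 := (unm_le hun (U.erase u)).1
      have e3 := card_erase_add_one hu
      have e4 : ¬ 2 ≤ tch G U u := fun k => hub (tch_two.1 k)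
      omega
    exact bad_unique hs (hS2 u (mem_insert_of_mem hu)) (hS2 v (mem_insert_of_mem hv)) hub hvb
      ((cut_iff _ _).1 hcut v (mem_erase.2 ⟨hvu, hv⟩))
  by_cases hcu : c u = c s
  · exact core hun c hc hs ht hst hS2 hT2 hpqs hsr hcu hgood
  · have hcu' : c u = c t := by
      have := hc s t hst
      revert this hcu
      cases c u <;> cases c s <;> cases c t <;> simp
    exact core hun c hc ht hs hst.symm hT2 hS2 hpqt htr hcu' hgood

end helpers

theorem stmt17 {V : Type*} [Fintype V] [DecidableEq V] (G : SimpleGraph V)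
    (hconn : G.Connected)
    (V1 V2 : Finset V) (hdisj : Disjoint V1 V2) (hcover : V1 ∪ V2 = Finset.univ)
    (hbip : ∀ a b, G.Adj a b → (a ∈ V1 ∧ b ∈ V2) ∨ (a ∈ V2 ∧ b ∈ V1))
    (hunmixed : Unmixed G)
    (S T : Finset V) (hS : IsCutSet G S) (hT : IsCutSet G T)
    (hcard : S.card = T.card) (hdiff : (S \ T).card = 1)
    (hunion : IsCutSet G (S ∪ T)) :
    IsCutSet G (S ∩ T) := by
  have hdiff' : (T \ S).card = 1 := by
    have h1 := card_sdiff_add_card_inter S T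
    have h2 := card_sdiff_add_card_inter T S
    rw [inter_comm T S] at h2
    omega
  obtain ⟨s, hs⟩ := card_eq_one.1 hdiff
  obtain ⟨t, ht⟩ := card_eq_one.1 hdiff'
  have hs' : ∀ x, (x ∈ S ∧ x ∉ T) ↔ x = s := by
    intro x; rw [← mem_sdiff, hs, mem_singleton]
  have ht' : ∀ x, (x ∈ T ∧ x ∉ S) ↔ x = t := by
    intro x; rw [← mem_sdiff, ht, mem_singleton]
  have hsS := (hs' s).2 rfl
  have htT := (ht' t).2 rfl
  have eS : insert s (S ∩ T) = S := by
    ext x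
    have := hs' x
    rw [mem_insert, mem_inter]; tauto
  have eT : insert t (S ∩ T) = T := by
    ext x
    have := ht' x
    rw [mem_insert, mem_inter]; tauto
  have eW : insert t (insert s (S ∩ T)) = S ∪ T := by
    rw [eS]
    ext x
    have := ht' x
    rw [mem_insert, mem_union]; tauto
  refine main_aux hunmixed (s := s) (t := t) (fun v => decide (v ∈ V1)) ?_ ?_ ?_ ?_ ?_ ?_ ?_
  · intro a b hab
    have hd := Finset.disjoint_left.1 hdisj
    rcases hbip a b hab with ⟨h1, h2⟩ | ⟨h1, h2⟩
    · have : b ∉ V1 := fun k => hd k h2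
      simp [h1, this]
    · have : a ∉ V1 := fun k => hd k h1
      simp [h2, this]
  · rw [mem_inter]; tauto
  · rw [mem_inter]; tauto
  · rintro rfl; exact htT.2 hsS.1
  · rw [eS]; exact hS
  · rw [eT]; exact hT
  · rw [eW]; exact hunion
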